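/- Let d ≥ 1 and a, c ≥ 0. There exists a constant C = C(d, a, c) < ∞ such that for all y₁, y₂ ∈ Z^d, ∑_{z ∈ Z^d} (ln(|y₁−z|+1 + |y₂−z|+1))^a / ((|y₁−z|+1)^{2d+1} + (|y₂−z|+1)^{2d+1}) · (ln(|z|+1))^c / (|z|+1)^{d−1} ≤ C · (ln(|y₁|+1 + |y₂|+1))^{a+c} / ((|y₁|+1)^{d−1} + (|y₂|+1)^{d−1}) · 1/(|y₁−y₂|+1)^{d+1}. -/

import Mathlib

/-- The Euclidean norm of a point of the lattice `ℤ^d`. -/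
noncomputable def latNorm {d : ℕ} (x : Fin d → ℤ) : ℝ :=
  Real.sqrt (∑ i, ((x i : ℝ)) ^ 2)

lemma latNorm_eq_norm {d : ℕ} (x : Fin d → ℤ) :
    latNorm x = ‖(WithLp.toLp 2 (fun i => (x i : ℝ)) : EuclideanSpace ℝ (Fin d))‖ := by
  simp [latNorm, EuclideanSpace.norm_eq]

lemma latNorm_nonneg {d : ℕ} (x : Fin d → ℤ) : 0 ≤ latNorm x := Real.sqrt_nonneg _

lemma latNorm_add_le {d : ℕ} (x y : Fin d → ℤ) : latNorm (x + y) ≤ latNorm x + latNorm y := by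
  simp only [latNorm_eq_norm]
  refine le_trans (le_of_eq ?_) (norm_add_le _ _)
  congr 1
  ext i
  simp

lemma latNorm_neg {d : ℕ} (x : Fin d → ℤ) : latNorm (-x) = latNorm x := by
  simp [latNorm]

lemma latNorm_sub_le {d : ℕ} (x y : Fin d → ℤ) : latNorm (x - y) ≤ latNorm x + latNorm y := by
  simpa [sub_eq_add_neg, latNorm_neg] using latNorm_add_le x (-y)

/-- The sup norm of a lattice point, as a natural number. -/
def latSup {d : ℕ} (x : Fin d → ℤ) : ℕ := Finset.univ.sup fun i => (x i).natAbs

lemma latSup_le_iff {d : ℕ} (x : Fin d → ℤ) (n : ℕ) :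
    latSup x ≤ n ↔ x ∈ Finset.Icc (fun _ : Fin d => -(n : ℤ)) (fun _ => (n : ℤ)) := by
  simp only [latSup, Finset.sup_le_iff, Finset.mem_univ, true_implies, Finset.mem_Icc, Pi.le_def,
    ← forall_and]
  exact forall_congr' fun i => by omega

lemma latSup_le_latNorm {d : ℕ} (x : Fin d → ℤ) : (latSup x : ℝ) ≤ latNorm x := by
  have h : ∀ i, ((x i).natAbs : ℝ) ≤ latNorm x := fun i => by
    refine Real.le_sqrt_of_sq_le ?_
    have : (((x i).natAbs : ℝ)) ^ 2 = (x i : ℝ) ^ 2 := by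
      rw [Nat.cast_natAbs, Int.cast_abs, sq_abs]
    rw [this]
    exact Finset.single_le_sum (f := fun i => (x i : ℝ) ^ 2) (fun _ _ => sq_nonneg _)
      (Finset.mem_univ i)
  have h' : latSup x ≤ ⌊latNorm x⌋₊ :=
    Finset.sup_le fun i _ => Nat.le_floor (h i)
  exact (Nat.cast_le.2 h').trans (Nat.floor_le (latNorm_nonneg x))

lemma card_latBox (d n : ℕ) :
    (Finset.Icc (fun _ : Fin d => -(n : ℤ)) (fun _ => (n : ℤ))).card = (2 * n + 1) ^ d := by
  rw [Pi.card_Icc]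
  simp only [Int.card_Icc, Finset.prod_const, Finset.card_univ, Fintype.card_fin]
  congr 1
  omega

lemma add_pow_succ_le (y t e : ℕ) :
    (y + t) ^ (e + 1) ≤ y ^ (e + 1) + (e + 1) * t * (y + t) ^ e := by
  induction e with
  | zero => simp
  | succ e ih =>
    calc (y + t) ^ (e + 1 + 1) = t * (y + t) ^ (e + 1) + y * (y + t) ^ (e + 1) := by ring
      _ ≤ t * (y + t) ^ (e + 1) + y * (y ^ (e + 1) + (e + 1) * t * (y + t) ^ e) := by gcongr
      _ = t * (y + t) ^ (e + 1) + y ^ (e + 1 + 1) + (e + 1) * t * (y * (y + t) ^ e) := by ring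
      _ ≤ t * (y + t) ^ (e + 1) + y ^ (e + 1 + 1)
          + (e + 1) * t * ((y + t) * (y + t) ^ e) := by gcongr; omega
      _ = _ := by ring

lemma card_filter_latSup_le (e n : ℕ) (s : Finset (Fin (e + 1) → ℤ)) :
    (s.filter fun z => latSup z = n).card ≤ (e + 1) * 2 ^ (e + 1) * (n + 1) ^ e := by
  rcases n with _ | n
  · have hsub : (s.filter fun z => latSup z = 0) ⊆
        Finset.Icc (fun _ : Fin (e + 1) => -((0 : ℕ) : ℤ)) (fun _ => ((0 : ℕ) : ℤ)) := fun z hz =>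
      (latSup_le_iff z 0).1 (Finset.mem_filter.1 hz).2.le
    have h := Finset.card_le_card hsub
    rw [card_latBox] at h
    have : 0 < (e + 1) * 2 ^ (e + 1) := by positivity
    simp only [mul_zero, zero_add, one_pow, mul_one] at h ⊢
    omega
  · set b : ℕ → Finset (Fin (e + 1) → ℤ) := fun n => Finset.Icc (fun _ => -(n : ℤ)) (fun _ => n)
    have hsub : (s.filter fun z => latSup z = n + 1) ⊆ b (n + 1) \ b n := by
      intro z hz
      have hz := (Finset.mem_filter.1 hz).2
      rw [Finset.mem_sdiff, ← latSup_le_iff, ← latSup_le_iff]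
      omega
    have hbb : b n ⊆ b (n + 1) := by
      intro z hz
      rw [← latSup_le_iff] at hz ⊢
      omega
    have h := Finset.card_le_card hsub
    rw [Finset.card_sdiff_of_subset hbb, card_latBox, card_latBox] at h
    have h2 := add_pow_succ_le (2 * n + 1) 2 e
    have h3 : (2 * n + 1 + 2) ^ e ≤ (2 * (n + 1 + 1)) ^ e := by gcongr; omega
    have h4 : (e + 1) * 2 * (2 * n + 1 + 2) ^ e ≤ (e + 1) * 2 ^ (e + 1) * (n + 1 + 1) ^ e := by
      calc _ ≤ (e + 1) * 2 * (2 * (n + 1 + 1)) ^ e := by gcongr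
        _ = _ := by rw [mul_pow]; ring
    have h5 : 2 * (n + 1) + 1 = 2 * n + 1 + 2 := by ring
    rw [h5] at h
    omega

lemma sum_range_inv_max_sq_le {D : ℝ} (hD : 1 ≤ D) (K : ℕ) :
    ∑ n ∈ Finset.range K, 1 / max D ((n : ℝ) + 1) ^ 2 ≤ 4 / D := by
  suffices h : ∑ n ∈ Finset.range K, 1 / max D ((n : ℝ) + 1) ^ 2 ≤ 4 / D - 4 / (D + K) by
    have : 0 ≤ 4 / (D + K) := by positivity
    linarith
  induction K with
  | zero => simp
  | succ K ih =>
    rw [Finset.sum_range_succ]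
    have hK : (0 : ℝ) ≤ K := Nat.cast_nonneg K
    have h1 : 1 / max D ((K : ℝ) + 1) ^ 2 ≤ 1 / ((D + (K + 1)) / 2) ^ 2 := by
      gcongr
      linarith [le_max_left D ((K : ℝ) + 1), le_max_right D ((K : ℝ) + 1)]
    have h2 : 1 / ((D + ((K : ℝ) + 1)) / 2) ^ 2 ≤ 4 / (D + K) - 4 / (D + (K + 1)) := by
      have e1 : 4 / (D + K) - 4 / (D + ((K : ℝ) + 1)) = 4 / ((D + K) * (D + (K + 1))) := by
        field_simp
        ring
      have e2 : 1 / ((D + ((K : ℝ) + 1)) / 2) ^ 2 = 4 / ((D + (K + 1)) * (D + (K + 1))) := by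
        field_simp
        ring
      rw [e1, e2]
      gcongr
      linarith
    push_cast
    linarith

/-- The radial weight `max(D, w)^{-(e+2)} w^{-e}`. -/
noncomputable def radialWeight (e : ℕ) (D w : ℝ) : ℝ := 1 / (max D w ^ (e + 2) * w ^ e)

lemma radialWeight_anti {e : ℕ} {D v w : ℝ} (hv : 0 < v) (hvw : v ≤ w) :
    radialWeight e D w ≤ radialWeight e D v := by
  have h1 : 0 < max D v := lt_max_of_lt_right hv
  have h2 : 0 < max D w := lt_max_of_lt_right (hv.trans_le hvw)
  unfold radialWeight
  gcongr

lemma sum_radialWeight_le (e : ℕ) {D : ℝ} (hD : 1 ≤ D) (s : Finset (Fin (e + 1) → ℤ)) :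
    ∑ z ∈ s, radialWeight e D (latNorm z + 1) ≤
      4 * ((e + 1) * 2 ^ (e + 1)) * (1 / D ^ (e + 1)) := by
  have hmaps : ∀ z ∈ s, latSup z ∈ Finset.range (s.sup latSup + 1) := fun z hz =>
    Finset.mem_range.2 (Nat.lt_succ_of_le (Finset.le_sup hz))
  calc ∑ z ∈ s, radialWeight e D (latNorm z + 1)
      ≤ ∑ z ∈ s, radialWeight e D ((latSup z : ℝ) + 1) := by
        refine Finset.sum_le_sum fun z _ => radialWeight_anti (by positivity) ?_
        linarith [latSup_le_latNorm z]
    _ = ∑ n ∈ Finset.range (s.sup latSup + 1), ∑ z ∈ s with latSup z = n,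
          radialWeight e D ((latSup z : ℝ) + 1) := (Finset.sum_fiberwise_of_maps_to hmaps _).symm
    _ ≤ ∑ n ∈ Finset.range (s.sup latSup + 1),
          ((e + 1) * 2 ^ (e + 1)) * (1 / D ^ e) * (1 / max D ((n : ℝ) + 1) ^ 2) := by
        refine Finset.sum_le_sum fun n _ => ?_
        have hcongr : ∑ z ∈ s with latSup z = n, radialWeight e D ((latSup z : ℝ) + 1) =
            (s.filter fun z => latSup z = n).card * radialWeight e D ((n : ℝ) + 1) := by
          rw [← nsmul_eq_mul, ← Finset.sum_const]
          refine Finset.sum_congr rfl fun z hz => ?_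
          rw [(Finset.mem_filter.1 hz).2]
        have hcard : ((s.filter fun z => latSup z = n).card : ℝ) ≤
            (e + 1) * 2 ^ (e + 1) * ((n : ℝ) + 1) ^ e := by
          exact_mod_cast card_filter_latSup_le e n s
        have hm : 0 < max D ((n : ℝ) + 1) := by positivity
        rw [hcongr]
        calc _ ≤ (e + 1) * 2 ^ (e + 1) * ((n : ℝ) + 1) ^ e * radialWeight e D ((n : ℝ) + 1) := by
              gcongr
              unfold radialWeight
              positivity
          _ = ((e + 1) * 2 ^ (e + 1)) * (1 / max D ((n : ℝ) + 1) ^ e)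
                * (1 / max D ((n : ℝ) + 1) ^ 2) := by
              unfold radialWeight
              field_simp
              ring
          _ ≤ _ := by
              gcongr
              exact le_max_left _ _
    _ = ((e + 1) * 2 ^ (e + 1)) * (1 / D ^ e) *
          ∑ n ∈ Finset.range (s.sup latSup + 1), 1 / max D ((n : ℝ) + 1) ^ 2 := by
        rw [Finset.mul_sum]
    _ ≤ ((e + 1) * 2 ^ (e + 1)) * (1 / D ^ e) * (4 / D) := by
        gcongr
        exact sum_range_inv_max_sq_le hD _
    _ = _ := by
        field_simp
        ring

lemma sum_radialWeight_sub_le (e : ℕ) {D : ℝ} (hD : 1 ≤ D) (y : Fin (e + 1) → ℤ)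
    (s : Finset (Fin (e + 1) → ℤ)) :
    ∑ z ∈ s, radialWeight e D (latNorm (y - z) + 1) ≤
      4 * ((e + 1) * 2 ^ (e + 1)) * (1 / D ^ (e + 1)) := by
  classical
  have h := sum_radialWeight_le e hD (s.image fun z => y - z)
  rwa [Finset.sum_image fun _ _ _ _ h => sub_right_injective h] at h

/-- Logarithms grow slower than any power. -/
lemma exists_log_add_rpow_le {k : ℝ} (hk : 0 ≤ k) :
    ∃ K : ℝ, 0 < K ∧ ∀ T S : ℝ, 2 ≤ T → 0 ≤ S →
      Real.log (T + S) ^ k ≤ K * Real.log T ^ k * (1 + S / T) := by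
  have hl2 : 0 < Real.log 2 := Real.log_pos (by norm_num)
  set Q : ℝ := 1 + (k + 1) / Real.log 2
  have hQ : 0 < Q := by positivity
  refine ⟨Q ^ k, by positivity, fun T S hT hS => ?_⟩
  have hT0 : 0 < T := by linarith
  set w : ℝ := 1 + S / T
  have hw : 1 ≤ w := le_add_of_nonneg_right (by positivity)
  have hlT : Real.log 2 ≤ Real.log T := Real.log_le_log (by norm_num) hT
  have hsplit : Real.log (T + S) = Real.log T + Real.log w := by
    rw [← Real.log_mul hT0.ne' (by linarith)]
    congr 1
    simp only [w]
    field_simp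
  have hlw : Real.log w ≤ (k + 1) * w ^ (1 / (k + 1)) := by
    have h := Real.log_le_rpow_div (x := w) (ε := 1 / (k + 1)) (by linarith) (by positivity)
    refine h.trans (le_of_eq ?_)
    field_simp
  have hw1 : 1 ≤ w ^ (1 / (k + 1)) := Real.one_le_rpow hw (by positivity)
  have hlog : Real.log (T + S) ≤ Q * Real.log T * w ^ (1 / (k + 1)) := by
    have h1 : Real.log w ≤ (k + 1) / Real.log 2 * Real.log T * w ^ (1 / (k + 1)) := by
      refine hlw.trans ?_
      have : k + 1 ≤ (k + 1) / Real.log 2 * Real.log T := by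
        rw [div_mul_eq_mul_div, le_div_iff₀ hl2]
        gcongr
      gcongr
    have h2 : Real.log T ≤ Real.log T * w ^ (1 / (k + 1)) :=
      le_mul_of_one_le_right (by linarith) hw1
    rw [hsplit]
    simp only [Q]
    linarith
  have hw0 : 0 ≤ w := by linarith
  have hlT0 : 0 ≤ Real.log T := by linarith
  calc Real.log (T + S) ^ k ≤ (Q * Real.log T * w ^ (1 / (k + 1))) ^ k :=
        Real.rpow_le_rpow (Real.log_nonneg (by linarith)) hlog hk
    _ = Q ^ k * Real.log T ^ k * w ^ (1 / (k + 1) * k) := by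
        rw [Real.mul_rpow (by positivity) (by positivity), Real.mul_rpow hQ.le hlT0,
          ← Real.rpow_mul hw0]
    _ ≤ Q ^ k * Real.log T ^ k * w ^ (1 : ℝ) := by
        gcongr
        rw [one_div_mul_eq_div, div_le_one (by linarith)]
        linarith
    _ = _ := by rw [Real.rpow_one]

lemma two_center_weight_le (e : ℕ) {A B N D T Y₁ Y₂ : ℝ} (hA : 1 ≤ A) (hB : 1 ≤ B) (hN : 1 ≤ N)
    (hD : 1 ≤ D) (hDS : D ≤ A + B) (hY₁ : 0 ≤ Y₁) (hY₂ : 0 ≤ Y₂)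
    (hTY : Y₁ + Y₂ = T) (hT : T ≤ 2 * N + (A + B)) :
    (Y₁ ^ e + Y₂ ^ e) * (1 / ((A + B) ^ (2 * e + 2) * N ^ e)) ≤
      2 * 3 ^ e * (2 * radialWeight e D A + radialWeight e D N) := by
  set S := A + B
  have hS : 0 < S := by positivity
  have hAS : A ≤ S := by simp only [S]; linarith
  have hN0 : 0 < N := by linarith
  have hA0 : 0 < A := by linarith
  have hT3 : T ^ e ≤ 3 ^ e * (N ^ e + S ^ e) := by
    rcases le_total N S with h | h
    · calc T ^ e ≤ (3 * S) ^ e := pow_le_pow_left₀ (by linarith) (by linarith) e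
        _ = 3 ^ e * S ^ e := mul_pow _ _ _
        _ ≤ _ := by gcongr; exact le_add_of_nonneg_left (by positivity)
    · calc T ^ e ≤ (3 * N) ^ e := pow_le_pow_left₀ (by linarith) (by linarith) e
        _ = 3 ^ e * N ^ e := mul_pow _ _ _
        _ ≤ _ := by gcongr; exact le_add_of_nonneg_right (by positivity)
  have hY : Y₁ ^ e + Y₂ ^ e ≤ 2 * T ^ e := by
    have h1 : Y₁ ^ e ≤ T ^ e := by gcongr; linarith
    have h2 : Y₂ ^ e ≤ T ^ e := by gcongr; linarith
    linarith
  have hmax : max D A ≤ S := max_le hDS hAS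
  have hfar : 1 / S ^ (2 * e + 2) ≤ radialWeight e D A := by
    have : S ^ (2 * e + 2) = S ^ (e + 2) * S ^ e := by ring
    rw [this]
    unfold radialWeight
    gcongr
  have hnear : 1 / (S ^ (e + 2) * N ^ e) ≤ radialWeight e D A + radialWeight e D N := by
    have hA' : 0 ≤ radialWeight e D A := by unfold radialWeight; positivity
    have hN' : 0 ≤ radialWeight e D N := by unfold radialWeight; positivity
    rcases le_total A N with h | h
    · have : 1 / (S ^ (e + 2) * N ^ e) ≤ radialWeight e D A := by
        unfold radialWeight
        gcongr
      linarith
    · have : 1 / (S ^ (e + 2) * N ^ e) ≤ radialWeight e D N := by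
        have hmax' : max D N ≤ S := max_le hDS (h.trans hAS)
        unfold radialWeight
        gcongr
      linarith
  calc (Y₁ ^ e + Y₂ ^ e) * (1 / (S ^ (2 * e + 2) * N ^ e))
      ≤ 2 * (3 ^ e * (N ^ e + S ^ e)) * (1 / (S ^ (2 * e + 2) * N ^ e)) := by
        gcongr
        linarith
    _ = 2 * 3 ^ e * (1 / S ^ (2 * e + 2) + 1 / (S ^ (e + 2) * N ^ e)) := by
        have : S ^ (2 * e + 2) = S ^ (e + 2) * S ^ e := by ring
        rw [this]
        field_simp
    _ ≤ _ := mul_le_mul_of_nonneg_left (by linarith) (by positivity)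

/-- Two-center lattice sum estimate: for `d ≥ 1` and `a, c ≥ 0` there is `C < ∞` with,
for all `y₁, y₂ ∈ ℤ^d`,
`∑_z (ln(|y₁−z|₊+|y₂−z|₊))^a/(|y₁−z|₊^{2d+1}+|y₂−z|₊^{2d+1}) · (ln|z|₊)^c/|z|₊^{d−1}
 ≤ C (ln(|y₁|₊+|y₂|₊))^{a+c}/(|y₁|₊^{d−1}+|y₂|₊^{d−1}) · 1/|y₁−y₂|₊^{d+1}`. -/
theorem lattice_two_center_sum (d : ℕ) (hd : 1 ≤ d) (a c : ℝ) (ha : 0 ≤ a) (hc : 0 ≤ c) :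
    ∃ C : ℝ, 0 < C ∧ ∀ y1 y2 : Fin d → ℤ,
      (∑' z : Fin d → ℤ,
          (Real.log ((latNorm (y1 - z) + 1) + (latNorm (y2 - z) + 1))) ^ a
              / ((latNorm (y1 - z) + 1) ^ (2 * d + 1) + (latNorm (y2 - z) + 1) ^ (2 * d + 1))
            * ((Real.log (latNorm z + 1)) ^ c / (latNorm z + 1) ^ (d - 1)))
        ≤ C * (Real.log ((latNorm y1 + 1) + (latNorm y2 + 1))) ^ (a + c)
              / ((latNorm y1 + 1) ^ (d - 1) + (latNorm y2 + 1) ^ (d - 1))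
            * (1 / (latNorm (y1 - y2) + 1) ^ (d + 1)) := by
  obtain ⟨e, rfl⟩ : ∃ e, d = e + 1 := ⟨d - 1, by omega⟩
  obtain ⟨K, hK, hlog⟩ := exists_log_add_rpow_le (add_nonneg ha hc)
  set G : ℝ := 4 * ((e + 1) * 2 ^ (e + 1))
  have hG : 0 < G := by positivity
  set P : ℝ := 2 ^ (2 * e + 2) * (2 * K) * (2 * 3 ^ e)
  have hP : 0 < P := by positivity
  refine ⟨P * (3 * G), by positivity, fun y1 y2 => ?_⟩
  rw [Nat.add_sub_cancel]
  set Y₁ := latNorm y1 + 1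
  set Y₂ := latNorm y2 + 1
  set D := latNorm (y1 - y2) + 1
  have hY₁ : 1 ≤ Y₁ := le_add_of_nonneg_left (latNorm_nonneg _)
  have hY₂ : 1 ≤ Y₂ := le_add_of_nonneg_left (latNorm_nonneg _)
  have hD : 1 ≤ D := le_add_of_nonneg_left (latNorm_nonneg _)
  have hlT : 0 < Real.log (Y₁ + Y₂) := Real.log_pos (by linarith)
  set W : ℝ := P * Real.log (Y₁ + Y₂) ^ (a + c) / (Y₁ ^ e + Y₂ ^ e) * (1 / D)
  have hW : 0 ≤ W := by positivity
  have hterm : ∀ z : Fin (e + 1) → ℤ,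
      (Real.log ((latNorm (y1 - z) + 1) + (latNorm (y2 - z) + 1))) ^ a
          / ((latNorm (y1 - z) + 1) ^ (2 * (e + 1) + 1)
            + (latNorm (y2 - z) + 1) ^ (2 * (e + 1) + 1))
        * ((Real.log (latNorm z + 1)) ^ c / (latNorm z + 1) ^ e) ≤
      W * (2 * radialWeight e D (latNorm (y1 - z) + 1) + radialWeight e D (latNorm z + 1)) := by
    intro z
    have hA : 1 ≤ latNorm (y1 - z) + 1 := le_add_of_nonneg_left (latNorm_nonneg _)
    have hB : 1 ≤ latNorm (y2 - z) + 1 := le_add_of_nonneg_left (latNorm_nonneg _)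
    have hN : 1 ≤ latNorm z + 1 := le_add_of_nonneg_left (latNorm_nonneg _)
    have hDS : D ≤ latNorm (y1 - z) + 1 + (latNorm (y2 - z) + 1) := by
      have h := latNorm_sub_le (y1 - z) (y2 - z)
      rw [sub_sub_sub_cancel_right] at h
      simp only [D]
      linarith
    have hDT : D ≤ Y₁ + Y₂ := by
      simp only [D, Y₁, Y₂]
      linarith [latNorm_sub_le y1 y2]
    have hT : Y₁ + Y₂ ≤
        2 * (latNorm z + 1) + (latNorm (y1 - z) + 1 + (latNorm (y2 - z) + 1)) := by
      have h1 := latNorm_add_le z (y1 - z)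
      have h2 := latNorm_add_le z (y2 - z)
      rw [add_sub_cancel] at h1 h2
      simp only [Y₁, Y₂]
      linarith
    have hNU : latNorm z + 1 ≤
        Y₁ + Y₂ + (latNorm (y1 - z) + 1 + (latNorm (y2 - z) + 1)) := by
      have h1 := latNorm_sub_le y1 (y1 - z)
      rw [sub_sub_cancel] at h1
      simp only [Y₁] at hY₁ ⊢
      linarith
    have hcore := two_center_weight_le e hA hB hN hD hDS (by linarith) (by linarith) rfl hT
    generalize latNorm (y1 - z) + 1 = A at *
    generalize latNorm (y2 - z) + 1 = B at *
    generalize latNorm z + 1 = N at *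
    have hA0 : 0 < A := by linarith
    have hB0 : 0 < B := by linarith
    have hN0 : 0 < N := by linarith
    have hlogs : Real.log (A + B) ^ a * Real.log N ^ c ≤
        2 * K * Real.log (Y₁ + Y₂) ^ (a + c) * ((A + B) / D) := by
      have hU : 0 < Real.log (Y₁ + Y₂ + (A + B)) := Real.log_pos (by linarith)
      calc Real.log (A + B) ^ a * Real.log N ^ c
          ≤ Real.log (Y₁ + Y₂ + (A + B)) ^ a * Real.log (Y₁ + Y₂ + (A + B)) ^ c := by
            have h1 : 0 ≤ Real.log (A + B) := Real.log_nonneg (by linarith)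
            have h2 : 0 ≤ Real.log N := Real.log_nonneg hN
            have h3 : Real.log (A + B) ≤ Real.log (Y₁ + Y₂ + (A + B)) :=
              Real.log_le_log (by linarith) (by linarith)
            gcongr
        _ = Real.log (Y₁ + Y₂ + (A + B)) ^ (a + c) := (Real.rpow_add hU a c).symm
        _ ≤ K * Real.log (Y₁ + Y₂) ^ (a + c) * (1 + (A + B) / (Y₁ + Y₂)) :=
            hlog _ _ (by linarith) (by linarith)
        _ ≤ K * Real.log (Y₁ + Y₂) ^ (a + c) * ((A + B) / D + (A + B) / D) := by
            have : 1 ≤ (A + B) / D := (one_le_div (by linarith)).2 hDS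
            gcongr
        _ = _ := by ring
    have hpow : (A + B) ^ (2 * (e + 1) + 1) ≤
        2 ^ (2 * e + 2) * (A ^ (2 * (e + 1) + 1) + B ^ (2 * (e + 1) + 1)) :=
      add_pow_le hA0.le hB0.le _
    have hinv : 1 / (A ^ (2 * (e + 1) + 1) + B ^ (2 * (e + 1) + 1)) ≤
        2 ^ (2 * e + 2) / (A + B) ^ (2 * (e + 1) + 1) := by
      rw [div_le_div_iff₀ (by positivity) (by positivity)]
      linarith
    have hY0 : 0 < Y₁ ^ e + Y₂ ^ e := by positivity
    calc Real.log (A + B) ^ a / (A ^ (2 * (e + 1) + 1) + B ^ (2 * (e + 1) + 1))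
          * (Real.log N ^ c / N ^ e)
        = (Real.log (A + B) ^ a * Real.log N ^ c)
          * (1 / (A ^ (2 * (e + 1) + 1) + B ^ (2 * (e + 1) + 1))) * (1 / N ^ e) := by ring
      _ ≤ (2 * K * Real.log (Y₁ + Y₂) ^ (a + c) * ((A + B) / D))
          * (2 ^ (2 * e + 2) / (A + B) ^ (2 * (e + 1) + 1)) * (1 / N ^ e) := by gcongr
      _ = 2 ^ (2 * e + 2) * (2 * K) * Real.log (Y₁ + Y₂) ^ (a + c) / (Y₁ ^ e + Y₂ ^ e) * (1 / D)
          * ((Y₁ ^ e + Y₂ ^ e) * (1 / ((A + B) ^ (2 * e + 2) * N ^ e))) := by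
          have : (A + B) ^ (2 * (e + 1) + 1) = (A + B) * (A + B) ^ (2 * e + 2) := by ring
          rw [this]
          field_simp
      _ ≤ 2 ^ (2 * e + 2) * (2 * K) * Real.log (Y₁ + Y₂) ^ (a + c) / (Y₁ ^ e + Y₂ ^ e) * (1 / D)
          * (2 * 3 ^ e * (2 * radialWeight e D A + radialWeight e D N)) := by gcongr
      _ = _ := by
          simp only [W, P]
          ring
  refine Real.tsum_le_of_sum_le (fun z => ?_) fun s => ?_
  · have hA := latNorm_nonneg (y1 - z)
    have hB := latNorm_nonneg (y2 - z)
    have hN := latNorm_nonneg z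
    have h1 := Real.log_nonneg (x := latNorm (y1 - z) + 1 + (latNorm (y2 - z) + 1)) (by linarith)
    have h2 := Real.log_nonneg (x := latNorm z + 1) (by linarith)
    positivity
  · refine (Finset.sum_le_sum fun z _ => hterm z).trans ?_
    rw [← Finset.mul_sum, Finset.sum_add_distrib, ← Finset.mul_sum]
    calc _ ≤ W * (2 * (G * (1 / D ^ (e + 1))) + G * (1 / D ^ (e + 1))) := by
          gcongr
          · exact sum_radialWeight_sub_le e hD y1 s
          · exact sum_radialWeight_le e hD s
      _ = _ := by
          simp only [W]
          field_simp
          ring
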